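/- arXiv:2509.00995 — 2 statements merged into one kernel-verified Lean document; each statement's English description precedes it below -/
import Mathlib

section
/- Let C be a braided monoidal category with braiding β, and let b be an object of C admitting a right dual bᘁ with coevaluation coev_b : 𝟙 ⟶ b ⊗ bᘁ. Let y be an object of C and θ : b ⊗ y ⟶ y ⊗ b a morphism such that, suppressing associators, the composite (𝟙_y ⊗ coev_b) ≫ (β_{y,b} ⊗ 𝟙_{bᘁ}) ≫ (θ ⊗ 𝟙_{bᘁ}) : y ⟶ (y ⊗ b) ⊗ bᘁ is equal to 𝟙_y ⊗ coev_b. Then θ = (β_{y,b})⁻¹, the inverse of the braiding β_{y,b} : y ⊗ b ⟶ b ⊗ y. -/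
/-!
Statement 0: In a braided monoidal category `C`, if `b` has a right dual `bd`
(witnessed by an exact pairing, with coevaluation `η_ b bd`), `y : C`, and
`θ : b ⊗ y ⟶ y ⊗ b` satisfies
`(y ◁ coev) ≫ α⁻¹ ≫ (β_{y,b} ▷ bd) ≫ (θ ▷ bd) = (y ◁ coev) ≫ α⁻¹`,
then `θ = (β_{y,b})⁻¹`.
-/

open CategoryTheory MonoidalCategory

theorem half_braiding_cancellation
    {C : Type*} [Category C] [MonoidalCategory C] [BraidedCategory C]
    (b bd : C) [ExactPairing b bd] (y : C) (θ : b ⊗ y ⟶ y ⊗ b)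
    (h : (y ◁ η_ b bd) ≫ (α_ y b bd).inv ≫ ((β_ y b).hom ▷ bd) ≫ (θ ▷ bd)
        = (y ◁ η_ b bd) ≫ (α_ y b bd).inv) :
    θ = (β_ y b).inv := by
  have hid : (β_ y b).hom ≫ θ = 𝟙 (y ⊗ b) := by
    apply (tensorRightHomEquiv y b bd (y ⊗ b)).injective
    simpa [tensorRightHomEquiv] using h
  exact (Iso.hom_comp_eq_id _).mp hid
end

section
/- Let C be a braided monoidal category with braiding β, and let (b, θ) be an object of the Drinfeld center of C, so that θ_x : b ⊗ x ≅ x ⊗ b is a half-braiding (natural in x and satisfying the hexagon axiom with respect to the tensor product). Suppose θ is enriched natural with respect to the self-enrichment of C given by the braiding, in the sense that for all objects w, x, y of C and every morphism f : w ⊗ x ⟶ y, suppressing associators, the composite (𝟙_w ⊗ θ_x) ≫ (f ⊗ 𝟙_b) : (w ⊗ b) ⊗ x ⟶ y ⊗ b is equal to the composite (β_{w,b} ⊗ 𝟙_x) ≫ (𝟙_b ⊗ f) ≫ θ_y, where β_{w,b} : w ⊗ b ⟶ b ⊗ w is the braiding. Then θ_x = (β_{x,b})⁻¹ for every object x; in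 particular the half-braiding θ is uniquely determined by the braiding of C. -/
/-!
Statement 1: Let `C` be a braided monoidal category and `(b, θ)` an object of
the Drinfeld center of `C` (so `θ` is a half-braiding on `b`).  If `θ` is
enriched natural with respect to the self-enrichment of `C` given by the
braiding, i.e. for all `w x y : C` and `f : w ⊗ x ⟶ y` (associators made
explicit)
`α ≫ (w ◁ θ_x) ≫ α⁻¹ ≫ (f ▷ b) = (β_{w,b} ▷ x) ≫ α ≫ (b ◁ f) ≫ θ_y`,
then `θ_x = (β_{x,b})⁻¹` for every `x`.
-/

open CategoryTheory MonoidalCategory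

theorem enriched_half_braiding_eq_inv_braiding
    {C : Type*} [Category C] [MonoidalCategory C] [BraidedCategory C]
    (b : C) (θ : HalfBraiding b)
    (h : ∀ (w x y : C) (f : w ⊗ x ⟶ y),
      (α_ w b x).hom ≫ (w ◁ (θ.β x).hom) ≫ (α_ w x b).inv ≫ (f ▷ b)
        = ((β_ w b).hom ▷ x) ≫ (α_ b w x).hom ≫ (b ◁ f) ≫ (θ.β y).hom) :
    ∀ x : C, (θ.β x).hom = (β_ x b).inv := by
  intro w
  have key : ((β_ w b).hom ≫ (θ.β w).hom) ▷ 𝟙_ C = 𝟙 (w ⊗ b) ▷ 𝟙_ C := by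
    rw [← cancel_mono ((α_ w b (𝟙_ C)).hom ≫ w ◁ (θ.β (𝟙_ C)).hom ≫ (α_ w (𝟙_ C) b).inv)]
    simpa using (h w (𝟙_ C) (w ⊗ 𝟙_ C) (𝟙 _)).symm
  exact (Iso.hom_comp_eq_id _).mp ((whiskerRight_iff _ _).mp key)
end
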